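/- arXiv:2504.19430 — 3 statements merged into one kernel-verified Lean document; each statement's English description precedes it below -/
import Mathlib

section
/- Assume sin(τ) = 0. For every choice of initial data (x₀, y₀, θ₀, φ₀, v_{s0}, v_{r0}) ∈ ℝ⁶ there exist p₁⁰, p₂⁰ ∈ ℝ such that every solution x, y, θ, φ, vₛ, vᵣ, p₁, p₂ of the regular system on an open interval I containing 0 with (x(0), y(0), θ(0), φ(0), vₛ(0), vᵣ(0), p₁(0), p₂(0)) = (x₀, y₀, θ₀, φ₀, v_{s0}, v_{r0}, p₁⁰, p₂⁰) satisfies (vₛ(t)² + vᵣ(t)²)·p₁(t) = 0 for all t ∈ I. -/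
open Real Set

/-- A solution of the reduced ODE system governing the D-regular constrained variational
trajectories of a disc (mass `m`, radius `R`, spinning inertia `Js`, rolling inertia `Jr`)
rolling without slip on a plane inclined at angle `τ`, on a set `I ⊆ ℝ`. -/
def IsRegularSolution (m g R Js Jr τ : ℝ) (I : Set ℝ)
    (x y θ φ vs vr p₁ p₂ : ℝ → ℝ) : Prop :=
  ∀ t ∈ I,
    HasDerivAt x (R * Real.cos (θ t) * vr t / Real.sqrt (Jr + m * R ^ 2)) t ∧
    HasDerivAt y (R * Real.sin (θ t) * vr t / Real.sqrt (Jr + m * R ^ 2)) t ∧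
    HasDerivAt θ (vs t / Real.sqrt Js) t ∧
    HasDerivAt φ (vr t / Real.sqrt (Jr + m * R ^ 2)) t ∧
    HasDerivAt vs 0 t ∧
    HasDerivAt vr (m * g * R * Real.sin τ * Real.cos (θ t) / Real.sqrt (Jr + m * R ^ 2)) t ∧
    HasDerivAt p₁
      ((Real.sqrt Jr * vs t * p₂ t - 2 * Real.sqrt m * R * vs t * vr t) /
          (Real.sqrt Js * Real.sqrt (Jr + m * R ^ 2)) -
        Real.sqrt m * g * Real.sin τ * Real.sin (θ t)) t ∧
    HasDerivAt p₂
      (-(Real.sqrt Jr * vs t * p₁ t) / (Real.sqrt Js * Real.sqrt (Jr + m * R ^ 2)) -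
        Real.sqrt m * Real.sqrt Jr * g * Real.sin τ * Real.cos (θ t) /
          Real.sqrt (Jr + m * R ^ 2)) t

theorem eq_of_hasDerivAt_zero_Ioo {f : ℝ → ℝ} {a b s t : ℝ}
    (hf : ∀ u ∈ Ioo a b, HasDerivAt f 0 u) (hs : s ∈ Ioo a b) (ht : t ∈ Ioo a b) :
    f s = f t :=
  isOpen_Ioo.is_const_of_deriv_eq_zero isPreconnected_Ioo
    (fun u hu => (hf u hu).differentiableAt.differentiableWithinAt)
    (fun u hu => (hf u hu).deriv) hs ht

/-- For `sin τ = 0`, every choice of initial data admits adjoint initial conditions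
`p₁(0), p₂(0)` for which any solution of the regular system stays in the kernel of
`F̂*_D`, i.e. all nonholonomic trajectories are regular constrained variational
trajectories for suitable choices of `p₁(0)` and `p₂(0)`. -/
theorem regular_horizontal_all_initial_conditions (m g R Js Jr τ : ℝ)
    (hm : 0 < m) (hg : 0 < g) (hR : 0 < R) (hJs : 0 < Js) (hJr : 0 < Jr)
    (hτ : Real.sin τ = 0) :
    ∀ x₀ y₀ θ₀ φ₀ vs₀ vr₀ : ℝ, ∃ q₁ q₂ : ℝ,
      ∀ (a b : ℝ) (x y θ φ vs vr p₁ p₂ : ℝ → ℝ),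
        (0 : ℝ) ∈ Set.Ioo a b →
        IsRegularSolution m g R Js Jr τ (Set.Ioo a b) x y θ φ vs vr p₁ p₂ →
        x 0 = x₀ → y 0 = y₀ → θ 0 = θ₀ → φ 0 = φ₀ →
        vs 0 = vs₀ → vr 0 = vr₀ → p₁ 0 = q₁ → p₂ 0 = q₂ →
        ∀ t ∈ Set.Ioo a b, (vs t ^ 2 + vr t ^ 2) * p₁ t = 0 := by
  intro x₀ y₀ θ₀ φ₀ vs₀ vr₀
  refine ⟨0, 2 * √m * R * vr₀ / √Jr, ?_⟩
  intro a b x y θ φ vs vr p₁ p₂ h0 h _ _ _ _ _ hvr₀ hp₁ hp₂ t ht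
  have hJr' : √Jr ≠ 0 := (Real.sqrt_pos.2 hJr).ne'
  have hvr : ∀ s ∈ Ioo a b, vr s = vr₀ := fun s hs =>
    (eq_of_hasDerivAt_zero_Ioo (fun u hu => by
      obtain ⟨_, _, _, _, _, hd, _⟩ := h u hu
      simpa [hτ] using hd) hs h0).trans hvr₀
  have energy : p₁ t ^ 2 + (p₂ t - 2 * √m * R * vr₀ / √Jr) ^ 2 =
      p₁ 0 ^ 2 + (p₂ 0 - 2 * √m * R * vr₀ / √Jr) ^ 2 :=
    eq_of_hasDerivAt_zero_Ioo
      (f := fun s => p₁ s ^ 2 + (p₂ s - 2 * √m * R * vr₀ / √Jr) ^ 2) (fun u hu => by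
        obtain ⟨_, _, _, _, _, _, hd₁, hd₂⟩ := h u hu
        refine ((hd₁.pow 2).add
          ((hd₂.sub_const (2 * √m * R * vr₀ / √Jr)).pow 2)).congr_deriv ?_
        rw [hvr u hu, hτ]
        simp only [mul_zero, zero_mul, zero_div, sub_zero, Nat.cast_ofNat,
          Nat.add_one_sub_one, pow_one]
        field_simp
        ring) ht h0
  rw [hp₁, hp₂] at energy
  have hp : p₁ t = 0 := by
    nlinarith [sq_nonneg (p₁ t), sq_nonneg (p₂ t - 2 * √m * R * vr₀ / √Jr)]
  rw [hp, mul_zero]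
end

section
/- Assume sin(τ) = 0. Let x, y, θ, φ, vₛ, vᵣ, p₁, p₂ be a solution of the singular system on an open interval I containing 0 with vₛ(0) = 0 and vᵣ(0) = 0. Then for every t ∈ I one has vₛ(t) = 0, vᵣ(t) = 0, p₁(t) = p₁(0), and p₂(t) = p₂(0); in particular (vₛ(t)² + vᵣ(t)²)·p₁(t) = 0 for all t ∈ I. -/
open Real Set

/-- A solution of the reduced ODE system governing the D-singular constrained variational
trajectories of a disc (mass `m`, radius `R`, spinning inertia `Js`, rolling inertia `Jr`)
rolling without slip on a plane inclined at angle `τ`, on a set `I ⊆ ℝ`. -/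
def IsSingularSolution (m g R Js Jr τ : ℝ) (I : Set ℝ)
    (x y θ φ vs vr p₁ p₂ : ℝ → ℝ) : Prop :=
  ∀ t ∈ I,
    HasDerivAt x (R * Real.cos (θ t) * vr t / Real.sqrt (Jr + m * R ^ 2)) t ∧
    HasDerivAt y (R * Real.sin (θ t) * vr t / Real.sqrt (Jr + m * R ^ 2)) t ∧
    HasDerivAt θ (vs t / Real.sqrt Js) t ∧
    HasDerivAt φ (vr t / Real.sqrt (Jr + m * R ^ 2)) t ∧
    HasDerivAt vs 0 t ∧
    HasDerivAt vr (m * g * R * Real.sin τ * Real.cos (θ t) / Real.sqrt (Jr + m * R ^ 2)) t ∧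
    HasDerivAt p₁
      (Real.sqrt Jr * vs t * p₂ t / (Real.sqrt Js * Real.sqrt (Jr + m * R ^ 2))) t ∧
    HasDerivAt p₂
      (-(Real.sqrt Jr * vs t * p₁ t) / (Real.sqrt Js * Real.sqrt (Jr + m * R ^ 2))) t

theorem eq_of_hasDerivAt_zero_of_mem_Ioo {f : ℝ → ℝ} {a b s t : ℝ}
    (hf : ∀ u ∈ Set.Ioo a b, HasDerivAt f 0 u) (hs : s ∈ Set.Ioo a b)
    (ht : t ∈ Set.Ioo a b) : f s = f t :=
  isOpen_Ioo.is_const_of_deriv_eq_zero isPreconnected_Ioo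
    (fun u hu => (hf u hu).differentiableAt.differentiableWithinAt)
    (fun u hu => (hf u hu).deriv) hs ht

theorem singular_horizontal_invariant_vs_vr (m g R Js Jr τ : ℝ)
    (hm : 0 < m) (hg : 0 < g) (hR : 0 < R) (hJs : 0 < Js) (hJr : 0 < Jr)
    (a b : ℝ) (hI : (0 : ℝ) ∈ Set.Ioo a b)
    (x y θ φ vs vr p₁ p₂ : ℝ → ℝ)
    (hsol : IsSingularSolution m g R Js Jr τ (Set.Ioo a b) x y θ φ vs vr p₁ p₂)
    (hτ : Real.sin τ = 0) (hvs0 : vs 0 = 0) (hvr0 : vr 0 = 0)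
    : ∀ t ∈ Set.Ioo a b, vs t = 0 ∧ vr t = 0 ∧ p₁ t = p₁ 0 ∧ p₂ t = p₂ 0 ∧
      (vs t ^ 2 + vr t ^ 2) * p₁ t = 0 := by
  have hvs : ∀ t ∈ Set.Ioo a b, vs t = 0 := fun t ht =>
    (eq_of_hasDerivAt_zero_of_mem_Ioo (fun u hu => (hsol u hu).2.2.2.2.1) ht hI).trans hvs0
  have hvr : ∀ t ∈ Set.Ioo a b, vr t = 0 := fun t ht =>
    (eq_of_hasDerivAt_zero_of_mem_Ioo
      (fun u hu => by simpa [hτ] using (hsol u hu).2.2.2.2.2.1) ht hI).trans hvr0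
  intro t ht
  refine ⟨hvs t ht, hvr t ht, ?_, ?_, by simp [hvs t ht, hvr t ht]⟩
  · exact eq_of_hasDerivAt_zero_of_mem_Ioo
      (fun u hu => by simpa [hvs u hu] using (hsol u hu).2.2.2.2.2.2.1) ht hI
  · exact eq_of_hasDerivAt_zero_of_mem_Ioo
      (fun u hu => by simpa [hvs u hu] using (hsol u hu).2.2.2.2.2.2.2) ht hI
end

section
/- Assume sin(τ) = 0. Let x, y, θ, φ, vₛ, vᵣ, p₁, p₂ be a solution of the singular system on an open interval I containing 0 such that (p₁(t), p₂(t)) ≠ (0, 0) for every t ∈ I. Then (vₛ(t)² + vᵣ(t)²)·p₁(t) = 0 holds for all t ∈ I if and only if vₛ(0) = 0 and at least one of the following holds: (a) p₁(0) = 0; (b) vᵣ(0) = 0. -/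
open Real Set

theorem eq_of_hasDerivAt_zero_on_Ioo {f : ℝ → ℝ} {a b : ℝ}
    (hf : ∀ t ∈ Set.Ioo a b, HasDerivAt f 0 t) {s t : ℝ}
    (hs : s ∈ Set.Ioo a b) (ht : t ∈ Set.Ioo a b) : f s = f t :=
  isOpen_Ioo.is_const_of_deriv_eq_zero isPreconnected_Ioo
    (fun u hu => (hf u hu).differentiableAt.differentiableWithinAt)
    (fun u hu => (hf u hu).deriv) hs ht

theorem singular_classification_horizontal (m g R Js Jr τ : ℝ)
    (hm : 0 < m) (hg : 0 < g) (hR : 0 < R) (hJs : 0 < Js) (hJr : 0 < Jr)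
    (a b : ℝ) (hI : (0 : ℝ) ∈ Set.Ioo a b)
    (x y θ φ vs vr p₁ p₂ : ℝ → ℝ)
    (hsol : IsSingularSolution m g R Js Jr τ (Set.Ioo a b) x y θ φ vs vr p₁ p₂)
    (hτ : Real.sin τ = 0) (hnz : ∀ t ∈ Set.Ioo a b, (p₁ t, p₂ t) ≠ (0, 0))
    : (∀ t ∈ Set.Ioo a b, (vs t ^ 2 + vr t ^ 2) * p₁ t = 0) ↔
      (vs 0 = 0 ∧ (p₁ 0 = 0 ∨ vr 0 = 0)) := by
  have hvs : ∀ t ∈ Set.Ioo a b, vs t = vs 0 := fun t ht =>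
    eq_of_hasDerivAt_zero_on_Ioo (fun u hu => (hsol u hu).2.2.2.2.1) ht hI
  have hvr : ∀ t ∈ Set.Ioo a b, vr t = vr 0 := fun t ht =>
    eq_of_hasDerivAt_zero_on_Ioo
      (fun u hu => by simpa [hτ] using (hsol u hu).2.2.2.2.2.1) ht hI
  constructor
  · intro h
    have hvs0 : vs 0 = 0 := by
      by_contra hne
      have hp₁ : ∀ t ∈ Set.Ioo a b, p₁ t = 0 := by
        intro t ht
        have hpos : 0 < vs t ^ 2 + vr t ^ 2 := by
          rw [hvs t ht]
          positivity
        exact (mul_eq_zero.mp (h t ht)).resolve_left hpos.ne'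
      have hzero : HasDerivAt p₁ 0 0 :=
        (hasDerivAt_const (0 : ℝ) (0 : ℝ)).congr_of_eventuallyEq
          (Filter.eventually_of_mem (isOpen_Ioo.mem_nhds hI) hp₁)
      have hd := (hsol 0 hI).2.2.2.2.2.2.1.unique hzero
      have hJr' : Real.sqrt Jr ≠ 0 := by positivity
      have hJs' : Real.sqrt Js ≠ 0 := by positivity
      have hα : Real.sqrt (Jr + m * R ^ 2) ≠ 0 := by positivity
      have hp₂ : p₂ 0 = 0 := by simpa [hJr', hJs', hα, hne] using hd
      exact hnz 0 hI (by rw [hp₁ 0 hI, hp₂])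
    refine ⟨hvs0, ?_⟩
    have h0 := h 0 hI
    simpa [hvs0, or_comm] using h0
  · rintro ⟨hvs0, h0⟩ t ht
    have hp₁ : p₁ t = p₁ 0 :=
      eq_of_hasDerivAt_zero_on_Ioo
        (fun u hu => by simpa [hvs u hu, hvs0] using (hsol u hu).2.2.2.2.2.2.1) ht hI
    rw [hvs t ht, hvr t ht, hp₁, hvs0]
    rcases h0 with h0 | h0 <;> simp [h0]
end
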